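/- Let A = {(α, β) ∈ ℝ² : α > 1, β > 1, n(α−1)(β+1) − α + β + 2 ≠ 0}. For any two distinct pairs (α, β), (α′, β′) ∈ A, the left-symmetric structures ∆_{(α,β)} and ∆_{(α′,β′)} on T*g are not isomorphic. In particular, for every integer n ≥ 2 the n-step nilpotent Lie algebra T*g admits uncountably many pairwise non-isomorphic complete left-symmetric structures. -/

import Mathlib

namespace Paper

open Finset

/-- Index type for the basis {z, e_1,…,e_n, f_1,…,f_n, t} of the cotangent Lie algebra
`T*g` of `g = ℝ ⋉_{J_n(0)} ℝ^n`.  The constructor `Bas.e i` (with `i : Fin n`)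
represents the basis vector `e_{i+1}` (math indexing `1,…,n`), similarly `Bas.f i`. -/
inductive Bas (n : ℕ) : Type
  | z : Bas n
  | t : Bas n
  | e : Fin n → Bas n
  | f : Fin n → Bas n
  deriving DecidableEq

/-- The underlying vector space of `T*g`, as coordinate functions on the basis. -/
abbrev V (n : ℕ) : Type := Bas n → ℝ

/-- The basis vectors of `T*g`. -/
noncomputable def bas (n : ℕ) (b : Bas n) : V n := Pi.single b 1

/-- The Lie bracket of `T*g`: the bilinear extension of
`[t, e_{i+1}] = e_i`, `[t, f_{i+1}] = -f_i`, `[e_{i+1}, f_{n-i+1}] = z` for `i = 1,…,n-1`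
(math indexing), all other brackets of basis vectors being zero. -/
noncomputable def bracket (n : ℕ) (x y : V n) : V n := fun b =>
  match b with
  | Bas.z => ∑ i : Fin n, ∑ j : Fin n,
      (if (i : ℕ) + (j : ℕ) = n then
        x (Bas.e i) * y (Bas.f j) - x (Bas.f j) * y (Bas.e i) else 0)
  | Bas.t => 0
  | Bas.e k => if h : (k : ℕ) + 1 < n then
      x Bas.t * y (Bas.e ⟨(k : ℕ) + 1, h⟩) - x (Bas.e ⟨(k : ℕ) + 1, h⟩) * y Bas.t else 0
  | Bas.f k => if h : (k : ℕ) + 1 < n then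
      -(x Bas.t * y (Bas.f ⟨(k : ℕ) + 1, h⟩)) + x (Bas.f ⟨(k : ℕ) + 1, h⟩) * y Bas.t else 0

/-- `αseq α i = α_i = (i(α-1)+1)/((α-1)(i-1)+1)`. -/
noncomputable def αseq (α : ℝ) (i : ℕ) : ℝ :=
  ((i : ℝ) * (α - 1) + 1) / ((α - 1) * ((i : ℝ) - 1) + 1)

/-- `βseq β i = β_i = (i(β+1)-1)/(-(β+1)(i-1)+1)`. -/
noncomputable def βseq (β : ℝ) (i : ℕ) : ℝ :=
  ((i : ℝ) * (β + 1) - 1) / (-(β + 1) * ((i : ℝ) - 1) + 1)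

/-- `γseq n α β i = γ_i = (α-1)((n-i)(β+1)-1)/(n(α-1)(β+1)-(α-1)+β+1)`. -/
noncomputable def γseq (n : ℕ) (α β : ℝ) (i : ℕ) : ℝ :=
  ((α - 1) * (((n : ℝ) - (i : ℝ)) * (β + 1) - 1)) /
    ((n : ℝ) * (α - 1) * (β + 1) - (α - 1) + β + 1)

/-- The standing conditions on `α, β`:
`k(α-1)+1 ≠ 0` and `k(β+1)-1 ≠ 0` for all integers `k ≥ 1`, and
`n(α-1)(β+1) - α + β + 2 ≠ 0`. -/
def Cond (n : ℕ) (α β : ℝ) : Prop :=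
  (∀ k : ℕ, 1 ≤ k → (k : ℝ) * (α - 1) + 1 ≠ 0) ∧
  (∀ k : ℕ, 1 ≤ k → (k : ℝ) * (β + 1) - 1 ≠ 0) ∧
  (n : ℝ) * (α - 1) * (β + 1) - α + β + 2 ≠ 0

/-- The product `∆_{(α,β)}` on `T*g`: the bilinear extension of
`t ∆ e_{i+1} = α_i e_i`, `e_{i+1} ∆ t = (α_i - 1) e_i`, `t ∆ f_{i+1} = β_i f_i`,
`f_{i+1} ∆ t = (β_i + 1) f_i`, `e_{i+1} ∆ f_{n-i+1} = γ_i z`,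
`f_{n-i+1} ∆ e_{i+1} = (γ_i - 1) z` for `i = 1,…,n-1` (math indexing),
all other products of basis vectors being zero. -/
noncomputable def lsa (n : ℕ) (α β : ℝ) (x y : V n) : V n := fun b =>
  match b with
  | Bas.z => ∑ i : Fin n, ∑ j : Fin n,
      (if (i : ℕ) + (j : ℕ) = n then
        γseq n α β (i : ℕ) * (x (Bas.e i) * y (Bas.f j))
          + (γseq n α β (i : ℕ) - 1) * (x (Bas.f j) * y (Bas.e i))
      else 0)
  | Bas.t => 0
  | Bas.e k => if h : (k : ℕ) + 1 < n then
      αseq α ((k : ℕ) + 1) * (x Bas.t * y (Bas.e ⟨(k : ℕ) + 1, h⟩))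
        + (αseq α ((k : ℕ) + 1) - 1) * (x (Bas.e ⟨(k : ℕ) + 1, h⟩) * y Bas.t)
      else 0
  | Bas.f k => if h : (k : ℕ) + 1 < n then
      βseq β ((k : ℕ) + 1) * (x Bas.t * y (Bas.f ⟨(k : ℕ) + 1, h⟩))
        + (βseq β ((k : ℕ) + 1) + 1) * (x (Bas.f ⟨(k : ℕ) + 1, h⟩) * y Bas.t)
      else 0

/-- `D` is a left-symmetric structure on `T*g`: the associator is symmetric in the
first two arguments and `x∆y - y∆x = [x,y]`. -/
def IsLSA (n : ℕ) (D : V n → V n → V n) : Prop :=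
  (∀ x y z : V n, D x (D y z) - D (D x y) z = D y (D x z) - D (D y x) z) ∧
  (∀ x y : V n, D x y - D y x = bracket n x y)

/-- Completeness: every right translation `y ↦ y ∆ x` is nilpotent. -/
def IsComplete (n : ℕ) (D : V n → V n → V n) : Prop :=
  ∀ x : V n, ∃ m : ℕ, ∀ y : V n, (fun w => D w x)^[m] y = 0

/-- Bilinearity of a product. -/
def IsBilin (n : ℕ) (D : V n → V n → V n) : Prop :=
  (∀ (c : ℝ) (x x' y : V n), D (c • x + x') y = c • D x y + D x' y) ∧
  (∀ (c : ℝ) (x y y' : V n), D x (c • y + y') = c • D x y + D x y')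

/-- Two left-symmetric structures on `T*g` are isomorphic if some Lie algebra
automorphism of `T*g` intertwines the products. -/
def LSAIso (n : ℕ) (D D' : V n → V n → V n) : Prop :=
  ∃ φ : V n ≃ₗ[ℝ] V n,
    (∀ x y, φ (bracket n x y) = bracket n (φ x) (φ y)) ∧
    (∀ x y, φ (D x y) = D' (φ x) (φ y))

/-- The 2-form `ω_λ = t* ∧ z* + ∑ λ_i e_i* ∧ f_{n-i+1}*` with `λ_i = λ - i + 1`. -/
noncomputable def omegaForm (n : ℕ) (lam : ℝ) (x y : V n) : ℝ :=
  (x Bas.t * y Bas.z - x Bas.z * y Bas.t) +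
  ∑ i : Fin n, (lam - ((i : ℕ) : ℝ)) *
    (x (Bas.e i) * y (Bas.f ⟨n - 1 - (i : ℕ), by have := i.isLt; omega⟩)
      - x (Bas.f ⟨n - 1 - (i : ℕ), by have := i.isLt; omega⟩) * y (Bas.e i))

/-- Two symplectic forms on `T*g` are symplectomorphic up to homothety if some Lie
algebra automorphism pulls one back to a nonzero multiple of the other. -/
def SympIso (n : ℕ) (ω ω' : V n → V n → ℝ) : Prop :=
  ∃ φ : V n ≃ₗ[ℝ] V n,
    (∀ x y, φ (bracket n x y) = bracket n (φ x) (φ y)) ∧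
    ∃ c : ℝ, c ≠ 0 ∧ ∀ x y, ω' (φ x) (φ y) = c * ω x y

/-- `ω` is a symplectic structure on `T*g`. -/
def IsSymplectic (n : ℕ) (ω : V n → V n → ℝ) : Prop :=
  (∀ (c : ℝ) (x x' y : V n), ω (c • x + x') y = c * ω x y + ω x' y) ∧
  (∀ x y : V n, ω x y = - ω y x) ∧
  (∀ x : V n, (∀ y, ω x y = 0) → x = 0) ∧
  (∀ x y z : V n, ω x (bracket n y z) + ω y (bracket n z x) + ω z (bracket n x y) = 0)

/-- The `e`-coordinates of a vector, extended by zero to all natural indices. -/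
noncomputable def ex {n : ℕ} (x : V n) (k : ℕ) : ℝ := if h : k < n then x (Bas.e ⟨k, h⟩) else 0

/-- The `f`-coordinates of a vector, extended by zero to all natural indices. -/
noncomputable def fx {n : ℕ} (x : V n) (k : ℕ) : ℝ := if h : k < n then x (Bas.f ⟨k, h⟩) else 0

lemma ex_ge {n : ℕ} (x : V n) {k : ℕ} (h : n ≤ k) : ex x k = 0 := by
  simp [ex, not_lt.mpr h]

lemma fx_ge {n : ℕ} (x : V n) {k : ℕ} (h : n ≤ k) : fx x k = 0 := by
  simp [fx, not_lt.mpr h]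

lemma ex_fin {n : ℕ} (x : V n) (i : Fin n) : ex x i = x (Bas.e i) := by
  simp [ex]

lemma fx_fin {n : ℕ} (x : V n) (i : Fin n) : fx x i = x (Bas.f i) := by
  simp [fx]

lemma vext {n : ℕ} {x y : V n} (hz : x Bas.z = y Bas.z) (ht : x Bas.t = y Bas.t)
    (he : ∀ k, ex x k = ex y k) (hf : ∀ k, fx x k = fx y k) : x = y := by
  funext b
  cases b with
  | z => exact hz
  | t => exact ht
  | e i => rw [← ex_fin x, ← ex_fin y, he]
  | f i => rw [← fx_fin x, ← fx_fin y, hf]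

@[simp] lemma ex_add {n : ℕ} (x y : V n) (k : ℕ) : ex (x + y) k = ex x k + ex y k := by
  unfold ex; split_ifs <;> simp
@[simp] lemma fx_add {n : ℕ} (x y : V n) (k : ℕ) : fx (x + y) k = fx x k + fx y k := by
  unfold fx; split_ifs <;> simp
@[simp] lemma ex_sub {n : ℕ} (x y : V n) (k : ℕ) : ex (x - y) k = ex x k - ex y k := by
  unfold ex; split_ifs <;> simp
@[simp] lemma fx_sub {n : ℕ} (x y : V n) (k : ℕ) : fx (x - y) k = fx x k - fx y k := by
  unfold fx; split_ifs <;> simp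
@[simp] lemma ex_smul {n : ℕ} (c : ℝ) (x : V n) (k : ℕ) : ex (c • x) k = c * ex x k := by
  unfold ex; split_ifs <;> simp
@[simp] lemma fx_smul {n : ℕ} (c : ℝ) (x : V n) (k : ℕ) : fx (c • x) k = c * fx x k := by
  unfold fx; split_ifs <;> simp
@[simp] lemma ex_zero {n : ℕ} (k : ℕ) : ex (0 : V n) k = 0 := by
  unfold ex; split_ifs <;> simp
@[simp] lemma fx_zero {n : ℕ} (k : ℕ) : fx (0 : V n) k = 0 := by
  unfold fx; split_ifs <;> simp

/-- A vector with prescribed coordinates. -/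
def mk (n : ℕ) (z t : ℝ) (e f : ℕ → ℝ) : V n := fun b =>
  match b with
  | Bas.z => z
  | Bas.t => t
  | Bas.e i => e i
  | Bas.f i => f i

lemma mk_z (n : ℕ) (z t : ℝ) (e f : ℕ → ℝ) : mk n z t e f Bas.z = z := rfl
lemma mk_t (n : ℕ) (z t : ℝ) (e f : ℕ → ℝ) : mk n z t e f Bas.t = t := rfl
lemma mk_e (n : ℕ) (z t : ℝ) (e f : ℕ → ℝ) (k : ℕ) :
    ex (mk n z t e f) k = if k < n then e k else 0 := by
  unfold ex; split_ifs <;> rfl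
lemma mk_f (n : ℕ) (z t : ℝ) (e f : ℕ → ℝ) (k : ℕ) :
    fx (mk n z t e f) k = if k < n then f k else 0 := by
  unfold fx; split_ifs <;> rfl

lemma sum_aux (n : ℕ) (g : ℕ → ℕ → ℝ) (h0 : g 0 n = 0) (hn : g n 0 = 0) :
    ∑ i : Fin n, ∑ j : Fin n, (if (i : ℕ) + (j : ℕ) = n then g i j else 0)
      = ∑ p ∈ antidiagonal n, g p.1 p.2 := by
  rw [Finset.Nat.sum_antidiagonal_eq_sum_range_succ (fun i j => g i j), Finset.sum_range_succ]
  simp only [Nat.sub_self, hn, add_zero]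
  rw [← Fin.sum_univ_eq_sum_range (fun i => g i (n - i))]
  refine Finset.sum_congr rfl fun i _ => ?_
  rw [Fin.sum_univ_eq_sum_range (fun j => if (i : ℕ) + j = n then g i j else 0)]
  have hi := i.isLt
  rw [Finset.sum_eq_single (n - (i : ℕ))]
  · rw [if_pos (by omega)]
  · intro b _ hb
    rw [if_neg (by omega)]
  · intro hb
    have : (i : ℕ) = 0 := by
      by_contra h
      exact hb (Finset.mem_range.mpr (by omega))
    rw [if_pos (by omega), this]
    simpa using h0

lemma lsa_z (n : ℕ) (α β : ℝ) (x y : V n) : lsa n α β x y Bas.z =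
    ∑ p ∈ antidiagonal n, (γseq n α β p.1 * (ex x p.1 * fx y p.2)
          + (γseq n α β p.1 - 1) * (fx x p.2 * ex y p.1)) := by
  rw [← sum_aux n (fun i j => γseq n α β i * (ex x i * fx y j)
          + (γseq n α β i - 1) * (fx x j * ex y i))]
  · simp only [lsa, ex_fin, fx_fin]
  · simp [fx_ge]
  · simp [ex_ge]

lemma lsa_t (n : ℕ) (α β : ℝ) (x y : V n) : lsa n α β x y Bas.t = 0 := rfl

lemma lsa_e (n : ℕ) (α β : ℝ) (x y : V n) (k : ℕ) : ex (lsa n α β x y) k =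
    αseq α (k + 1) * (x Bas.t * ex y (k + 1))
        + (αseq α (k + 1) - 1) * (ex x (k + 1) * y Bas.t) := by
  by_cases h : k + 1 < n
  · have h' : k < n := by omega
    simp [ex, lsa, h, h']
  · rw [ex_ge y (not_lt.mp h), ex_ge x (not_lt.mp h)]
    simp [ex, lsa, h]

lemma lsa_f (n : ℕ) (α β : ℝ) (x y : V n) (k : ℕ) : fx (lsa n α β x y) k =
    βseq β (k + 1) * (x Bas.t * fx y (k + 1))
        + (βseq β (k + 1) + 1) * (fx x (k + 1) * y Bas.t) := by
  by_cases h : k + 1 < n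
  · have h' : k < n := by omega
    simp [fx, lsa, h, h']
  · rw [fx_ge y (not_lt.mp h), fx_ge x (not_lt.mp h)]
    simp [fx, lsa, h]

lemma br_z (n : ℕ) (x y : V n) : bracket n x y Bas.z =
    ∑ p ∈ antidiagonal n, (ex x p.1 * fx y p.2 - fx x p.2 * ex y p.1) := by
  rw [← sum_aux n (fun i j => ex x i * fx y j - fx x j * ex y i)]
  · simp only [bracket, ex_fin, fx_fin]
  · simp [fx_ge]
  · simp [ex_ge]

lemma br_t (n : ℕ) (x y : V n) : bracket n x y Bas.t = 0 := rfl

lemma br_e (n : ℕ) (x y : V n) (k : ℕ) : ex (bracket n x y) k =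
    x Bas.t * ex y (k + 1) - ex x (k + 1) * y Bas.t := by
  by_cases h : k + 1 < n
  · have h' : k < n := by omega
    simp [ex, bracket, h, h']
  · rw [ex_ge y (not_lt.mp h), ex_ge x (not_lt.mp h)]
    simp [ex, bracket, h]

lemma br_f (n : ℕ) (x y : V n) (k : ℕ) : fx (bracket n x y) k =
    -(x Bas.t * fx y (k + 1)) + fx x (k + 1) * y Bas.t := by
  by_cases h : k + 1 < n
  · have h' : k < n := by omega
    simp [fx, bracket, h, h']
  · rw [fx_ge y (not_lt.mp h), fx_ge x (not_lt.mp h)]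
    simp [fx, bracket, h]

/-! ### The structures are bilinear, left-symmetric and complete -/

lemma lsa_bilin (n : ℕ) (α β : ℝ) : IsBilin n (lsa n α β) := by
  constructor
  · intro c x x' y
    apply vext
    · simp only [lsa_z, Pi.add_apply, Pi.smul_apply, smul_eq_mul, Finset.mul_sum,
        ← Finset.sum_add_distrib, ex_add, fx_add, ex_smul, fx_smul]
      exact Finset.sum_congr rfl fun p _ => by ring
    · simp [lsa_t]
    · intro k; simp only [lsa_e, ex_add, ex_smul, Pi.add_apply, Pi.smul_apply, smul_eq_mul]; ring
    · intro k; simp only [lsa_f, fx_add, fx_smul, Pi.add_apply, Pi.smul_apply, smul_eq_mul]; ring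
  · intro c x y y'
    apply vext
    · simp only [lsa_z, Pi.add_apply, Pi.smul_apply, smul_eq_mul, Finset.mul_sum,
        ← Finset.sum_add_distrib, ex_add, fx_add, ex_smul, fx_smul]
      exact Finset.sum_congr rfl fun p _ => by ring
    · simp [lsa_t]
    · intro k; simp only [lsa_e, ex_add, ex_smul, Pi.add_apply, Pi.smul_apply, smul_eq_mul]; ring
    · intro k; simp only [lsa_f, fx_add, fx_smul, Pi.add_apply, Pi.smul_apply, smul_eq_mul]; ring

lemma lsa_br (n : ℕ) (α β : ℝ) (x y : V n) :
    lsa n α β x y - lsa n α β y x = bracket n x y := by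
  apply vext
  · simp only [lsa_z, br_z, Pi.sub_apply, ← Finset.sum_sub_distrib]
    exact Finset.sum_congr rfl fun p _ => by ring
  · simp [lsa_t, br_t]
  · intro k; simp only [lsa_e, br_e, ex_sub]; ring
  · intro k; simp only [lsa_f, br_f, fx_sub]; ring

lemma shift_sum (n : ℕ) (G : ℕ → ℕ → ℝ) (h0 : G 0 (n + 1) = 0) (h1 : G (n + 1) 0 = 0) :
    ∑ p ∈ antidiagonal n, G p.1 (p.2 + 1) = ∑ p ∈ antidiagonal n, G (p.1 + 1) p.2 := by
  have a := Finset.Nat.sum_antidiagonal_succ (n := n) (f := fun p : ℕ × ℕ => G p.1 p.2)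
  have b := Finset.Nat.sum_antidiagonal_succ' (n := n) (f := fun p : ℕ × ℕ => G p.1 p.2)
  simp only [h0, h1] at a b
  linarith

section LS
variable {α β : ℝ}

lemma denA (hα : 1 < α) (i : ℕ) : 0 < (i : ℝ) * (α - 1) + 1 := by
  have : (0 : ℝ) ≤ (i : ℝ) * (α - 1) := mul_nonneg (Nat.cast_nonneg i) (by linarith)
  linarith

lemma denB (hβ : 1 < β) (i : ℕ) : 0 < ((i : ℝ) + 1) * (β + 1) - 1 := by
  have : (0 : ℝ) ≤ (i : ℝ) * (β + 1) := mul_nonneg (Nat.cast_nonneg i) (by linarith)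
  linarith

lemma denC (n : ℕ) (hn : 1 ≤ n) (hα : 1 < α) (hβ : 1 < β) :
    0 < (n : ℝ) * (α - 1) * (β + 1) - (α - 1) + β + 1 := by
  have h1 : (1 : ℝ) ≤ n := by exact_mod_cast hn
  have h2 : 0 < (α - 1) * (β + 1) := mul_pos (by linarith) (by linarith)
  have h3 : 0 ≤ ((n : ℝ) - 1) * ((α - 1) * (β + 1)) := mul_nonneg (by linarith) h2.le
  have h4 : 0 < (α - 1) * β := mul_pos (by linarith) (by linarith)
  nlinarith

lemma αseq_eq (hα : 1 < α) (i : ℕ) :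
    αseq α (i + 1) = 1 + (α - 1) / ((i : ℝ) * (α - 1) + 1) := by
  have h := denA hα i
  unfold αseq
  push_cast
  rw [show (α - 1) * ((i : ℝ) + 1 - 1) + 1 = (i : ℝ) * (α - 1) + 1 by ring]
  field_simp
  ring

lemma βseq_one : βseq β 1 = β := by simp [βseq]

lemma βseq_eq (hβ : 1 < β) (i : ℕ) :
    βseq β (i + 2) = -1 - (β + 1) / (((i : ℝ) + 1) * (β + 1) - 1) := by
  have h := denB hβ i
  unfold βseq
  push_cast
  rw [show -(β + 1) * ((i : ℝ) + 2 - 1) + 1 = -(((i : ℝ) + 1) * (β + 1) - 1) by ring,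
    show ((i : ℝ) + 2) * (β + 1) - 1 = (((i : ℝ) + 1) * (β + 1) - 1) + (β + 1) by ring]
  generalize ((i : ℝ) + 1) * (β + 1) - 1 = u at *
  field_simp
  ring

lemma α_rec (hα : 1 < α) (i : ℕ) :
    αseq α (i + 2) - αseq α (i + 1)  + (αseq α (i + 2) - 1) * (αseq α (i + 1) - 1) = 0 := by
  have h1 := denA hα i
  have h2 := denA hα (i + 1)
  rw [αseq_eq hα, αseq_eq hα]
  push_cast at h2 ⊢
  rw [show ((i : ℝ) + 1) * (α - 1) + 1 = (i : ℝ) * (α - 1) + 1 + (α - 1) by ring] at *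
  generalize (i : ℝ) * (α - 1) + 1 = u at *
  generalize α - 1 = v at *
  field_simp
  ring

lemma β_rec (hβ : 1 < β) (i : ℕ) :
    βseq β (i + 2) - βseq β (i + 1)  - (βseq β (i + 2) + 1) * (βseq β (i + 1) + 1) = 0 := by
  cases i with
  | zero =>
    have h1 : β ≠ 0 := by linarith
    rw [zero_add, βseq_one, ← zero_add 2, βseq_eq hβ]
    simp only [Nat.cast_zero, zero_add, one_mul, add_sub_cancel_right]
    field_simp
    ring
  | succ i =>
    have h1 := denB hβ i
    have h2 := denB hβ (i + 1)
    rw [show i + 1 + 1 = i + 2 by ring, βseq_eq hβ, βseq_eq hβ]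
    push_cast at h1 h2 ⊢
    rw [show ((i : ℝ) + 1 + 1) * (β + 1) - 1 = ((i : ℝ) + 1) * (β + 1) - 1 + (β + 1) by ring] at *
    generalize ((i : ℝ) + 1) * (β + 1) - 1 = u at *
    generalize β + 1 = v at *
    field_simp
    ring

variable (α β) in
/-- The three identities linking the sequences. -/
lemma γ_rec (n : ℕ) (hα : 1 < α) (hβ : 1 < β) (i j : ℕ) (hij : i + (j + 2) = n)  :
    -γseq n α β (i) = βseq β (j + 2) * γseq n α β (i + 1) ∧
    (γseq n α β (i + 1) - 1) = αseq α (i + 1) * (γseq n α β i - 1) ∧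
    (βseq β (j + 2) + 1) * γseq n α β (i + 1) =
      (αseq α (i + 1) - 1) * (γseq n α β i - 1) := by
  have h1 := denA hα i
  have h2 := denB hβ j
  have h3 := denC (α := α) (β := β) n (by omega) hα hβ
  subst hij
  rw [βseq_eq hβ, αseq_eq hα]
  unfold γseq
  push_cast at h3 ⊢
  generalize hd : ((i : ℝ) + (j + 2)) * (α - 1) * (β + 1) - (α - 1) + β + 1 = d at *
  generalize hu : (i : ℝ) * (α - 1) + 1 = u at *
  generalize hv : ((j : ℝ) + 1) * (β + 1) - 1 = v at *
  refine ⟨?_, ?_, ?_⟩ <;> field_simp <;> subst hd <;> subst hu <;> subst hv <;> ring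

end LS

lemma lsa_assoc (n : ℕ) {α β : ℝ} (hα : 1 < α) (hβ : 1 < β) (x y w : V n) :
    lsa n α β x (lsa n α β y w) - lsa n α β (lsa n α β x y) w =
      lsa n α β y (lsa n α β x w) - lsa n α β (lsa n α β y x) w := by
  apply vext
  · simp only [lsa_z, Pi.sub_apply, lsa_e, lsa_f]
    rw [← sub_eq_zero]
    simp only [← Finset.sum_sub_distrib]
    have key := shift_sum n (fun i j => γseq n α β i *
      (ex x i * (βseq β j * (y Bas.t * fx w j) + (βseq β j + 1) * (fx y j * w Bas.t))
       - ex y i * (βseq β j * (x Bas.t * fx w j) + (βseq β j + 1) * (fx x j * w Bas.t)))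
       - (γseq n α β i - 1) * (βseq β j * (x Bas.t * fx y j) + (βseq β j + 1) * (fx x j * y Bas.t)
         - (βseq β j * (y Bas.t * fx x j) + (βseq β j + 1) * (fx y j * x Bas.t))) * ex w i)
      (by simp [fx_ge]) (by simp [ex_ge])
    rw [← sub_eq_zero, ← Finset.sum_sub_distrib] at key
    refine Eq.trans ?_ key
    rw [← sub_eq_zero, ← Finset.sum_sub_distrib]
    refine Finset.sum_eq_zero fun p hp => ?_
    obtain ⟨i, j⟩ := p
    have hp' : i + j = n := by simpa using hp
    dsimp only
    rcases Nat.lt_or_ge j 2 with hj | hj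
    · have hx : ∀ v : V n, ex v (i + 1) = 0 := fun v => ex_ge v (by omega)
      simp only [hx]
      ring
    · obtain ⟨j, rfl⟩ := Nat.exists_eq_add_of_le' hj
      obtain ⟨r1, r2, r3⟩ := γ_rec α β n hα hβ i j hp'
      linear_combination
        -((ex x (i + 1) * y Bas.t - ex y (i + 1) * x Bas.t) * fx w (j + 2)) * r1
        - ((y Bas.t * fx x (j + 2) - x Bas.t * fx y (j + 2)) * ex w (i + 1)) * r2
        + ((ex x (i + 1) * fx y (j + 2) - ex y (i + 1) * fx x (j + 2)) * w Bas.t) * r3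
  · simp [lsa_t]
  · intro k
    simp only [ex_sub, lsa_e, lsa_t]
    linear_combination (w Bas.t) * (x Bas.t * ex y (k + 1 + 1) - y Bas.t * ex x (k+1+1)) * α_rec hα k
  · intro k
    simp only [fx_sub, lsa_f, lsa_t]
    linear_combination -(w Bas.t) * (x Bas.t * fx y (k + 1 + 1) - y Bas.t * fx x (k+1+1)) * β_rec hβ k

lemma lsa_complete (n : ℕ) (α β : ℝ) : IsComplete n (lsa n α β) := by
  intro x
  have key : ∀ m : ℕ, ∀ y : V n, ((fun w => lsa n α β w x)^[m + 1] y) Bas.t = 0 ∧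
      ∀ k, n ≤ k + m + 1 → ex ((fun w => lsa n α β w x)^[m + 1] y) k = 0 ∧
        fx ((fun w => lsa n α β w x)^[m + 1] y) k = 0 := by
    intro m y
    induction m with
    | zero =>
      refine ⟨rfl, fun k hk => ?_⟩
      simp only [zero_add, Function.iterate_one, lsa_e, lsa_f]
      rw [ex_ge x (by omega), ex_ge y (by omega), fx_ge x (by omega), fx_ge y (by omega)]
      simp
    | succ m ih =>
      rw [Function.iterate_succ_apply']
      refine ⟨rfl, fun k hk => ?_⟩
      have h := ih.2 (k + 1) (by omega)
      simp only [lsa_e, lsa_f]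
      rw [ih.1, h.1, h.2]
      simp
  refine ⟨n + 2, fun y => ?_⟩
  rw [Function.iterate_succ_apply']
  have h := key n y
  apply vext
  · simp only [lsa_z]
    refine Finset.sum_eq_zero fun p _ => ?_
    rw [(h.2 p.1 (by omega)).1, (h.2 p.2 (by omega)).2]
    ring
  · rfl
  · intro k
    simp only [lsa_e]
    rw [h.1, (h.2 (k + 1) (by omega)).1]
    simp
  · intro k
    simp only [lsa_f]
    rw [h.1, (h.2 (k + 1) (by omega)).2]
    simp

/-! ### Non-isomorphism -/

/-- The basis vectors. -/
def tt (n : ℕ) : V n := mk n 0 1 (fun _ => 0) (fun _ => 0)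
def ee (n k : ℕ) : V n := mk n 0 0 (fun i => if i = k then 1 else 0) (fun _ => 0)
def ff (n k : ℕ) : V n := mk n 0 0 (fun _ => 0) (fun i => if i = k then 1 else 0)

lemma tt_t (n : ℕ) : tt n Bas.t = 1 := rfl
lemma ee_t (n k : ℕ) : ee n k Bas.t = 0 := rfl
lemma ff_t (n k : ℕ) : ff n k Bas.t = 0 := rfl
lemma tt_z (n : ℕ) : tt n Bas.z = 0 := rfl
lemma ee_z (n k : ℕ) : ee n k Bas.z = 0 := rfl
lemma ff_z (n k : ℕ) : ff n k Bas.z = 0 := rfl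
lemma tt_e (n k : ℕ) : ex (tt n) k = 0 := by simp [tt, mk_e]
lemma tt_f (n k : ℕ) : fx (tt n) k = 0 := by simp [tt, mk_f]
lemma ee_f (n k i : ℕ) : fx (ee n k) i = 0 := by simp [ee, mk_f]
lemma ff_e (n k i : ℕ) : ex (ff n k) i = 0 := by simp [ff, mk_e]
lemma ee_e (n k i : ℕ) (hk : k < n) : ex (ee n k) i = if i = k then 1 else 0 := by
  rw [ee, mk_e]; split_ifs <;> first | rfl | omega
lemma ff_f (n k i : ℕ) (hk : k < n) : fx (ff n k) i = if i = k then 1 else 0 := by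
  rw [ff, mk_f]; split_ifs <;> first | rfl | omega

lemma lsa_tt (n : ℕ) (α β : ℝ) : lsa n α β (tt n) (tt n) = 0 := by
  apply vext <;> simp [lsa_z, lsa_t, lsa_e, lsa_f, tt_e, tt_f]

lemma lsa_ee (n : ℕ) (α β : ℝ) (k : ℕ) : lsa n α β (ee n k) (ee n k) = 0 := by
  apply vext <;> simp [lsa_z, lsa_t, lsa_e, lsa_f, ee_f, ee_t]

lemma lsa_ff (n : ℕ) (α β : ℝ) (k : ℕ) : lsa n α β (ff n k) (ff n k) = 0 := by
  apply vext <;> simp [lsa_z, lsa_t, lsa_e, lsa_f, ff_e, ff_t]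

lemma lsa_te (m : ℕ) (α β : ℝ) : lsa (m + 2) α β (tt _) (ee _ (m + 1)) =
    αseq α (m + 1) • bracket (m + 2) (tt _) (ee _ (m + 1)) := by
  apply vext
  · simp [lsa_z, br_z, tt_e, tt_f]
  · simp [lsa_t, br_t]
  · intro k
    rw [ex_smul, lsa_e, br_e, ee_e _ _ _ (by omega), tt_e, tt_t, ee_t]
    by_cases h : k = m
    · subst h; simp
    · simp [h]
  · intro k
    simp [lsa_f, br_f, tt_f, tt_t, ee_f]

lemma lsa_tf (m : ℕ) (α β : ℝ) : lsa (m + 2) α β (tt _) (ff _ (m + 1)) =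
    (-βseq β (m + 1)) • bracket (m + 2) (tt _) (ff _ (m + 1)) := by
  apply vext
  · simp [lsa_z, br_z, tt_e, tt_f]
  · simp [lsa_t, br_t]
  · intro k
    rw [ex_smul, lsa_e, br_e]
    simp [tt_e, tt_t, ff_e]
  · intro k
    rw [fx_smul, lsa_f, br_f, ff_f _ _ _ (by omega), tt_f, tt_t, ff_t]
    by_cases h : k = m
    · subst h; simp
    · simp [h]

lemma lsa_ef (m : ℕ) (hm : 1 ≤ m) (α β : ℝ) :
    lsa (m + 2) α β (ee _ (m + 1)) (ff _ (m + 1)) = 0 := by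
  apply vext
  · simp only [lsa_z]
    refine Finset.sum_eq_zero fun p hp => ?_
    have hp' : p.1 + p.2 = m + 2 := by simpa using hp
    rw [ee_f, ff_f _ _ _ (by omega), ee_e _ _ _ (by omega)]
    by_cases h : p.1 = m + 1
    · rw [if_neg (show ¬ p.2 = m + 1 by omega)]; simp
    · rw [if_neg h]; simp
  all_goals simp [lsa_t, lsa_e, lsa_f, ee_t, ff_t]

lemma lsa_fe (m : ℕ) (hm : 1 ≤ m) (α β : ℝ) :
    lsa (m + 2) α β (ff _ (m + 1)) (ee _ (m + 1)) = 0 := by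
  apply vext
  · simp only [lsa_z]
    refine Finset.sum_eq_zero fun p hp => ?_
    have hp' : p.1 + p.2 = m + 2 := by simpa using hp
    rw [ee_f, ff_f _ _ _ (by omega), ee_e _ _ _ (by omega)]
    by_cases h : p.1 = m + 1
    · rw [if_neg (show ¬ p.2 = m + 1 by omega)]; simp
    · rw [if_neg h]; simp
  all_goals simp [lsa_t, lsa_e, lsa_f, ee_t, ff_t]

/-- Vectors without `t, e_n, f_n` components are sums of two brackets. -/
lemma derived (m : ℕ) (v : V (m + 2)) (ht : v Bas.t = 0) (he : ex v (m + 1) = 0)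
    (hf : fx v (m + 1) = 0) : ∃ a b c d : V (m + 2),
      v = bracket (m + 2) a b + bracket (m + 2) c d := by
  refine ⟨tt _, mk _ 0 0 (fun k => ex v (k - 1)) (fun k => - fx v (k - 1)),
    ee _ (m + 1), (v Bas.z) • ff _ 1, ?_⟩
  apply vext
  · simp only [Pi.add_apply, br_z, tt_e, tt_f, ee_f]
    rw [Finset.sum_eq_zero (by intros; simp), Finset.sum_eq_single (m + 1, 1)]
    · simp [ee_e, ff_f]
    · rintro ⟨i, j⟩ hp hne
      have hp' : i + j = m + 2 := by simpa using hp
      have : i ≠ m + 1 := by rintro rfl; apply hne; congr 1; omega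
      simp [ee_e, this]
    · simp
  · simp [br_t, ht]
  · intro k
    simp only [ex_add, br_e, tt_t, tt_e, ee_t, ff_t, Pi.smul_apply, mk_e, smul_eq_mul]
    by_cases h : k + 1 < m + 2
    · simp [h]
    · rcases Nat.lt_or_ge (m + 1) k with h' | h'
      · simp [h, ex_ge v (show m + 2 ≤ k by omega)]
      · have : k = m + 1 := by omega
        subst this; simp [he]
  · intro k
    simp only [fx_add, br_f, tt_t, tt_f, ee_t, ee_f, Pi.smul_apply, mk_f, smul_eq_mul]
    by_cases h : k + 1 < m + 2
    · simp [h]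
    · rcases Nat.lt_or_ge (m + 1) k with h' | h'
      · simp [h, fx_ge v (show m + 2 ≤ k by omega)]
      · have : k = m + 1 := by omega
        subst this; simp [hf]

lemma br_top (m : ℕ) (x y : V (m + 2)) : bracket (m + 2) x y Bas.t = 0 ∧
    ex (bracket (m + 2) x y) (m + 1) = 0 ∧ fx (bracket (m + 2) x y) (m + 1) = 0 := by
  refine ⟨rfl, ?_, ?_⟩
  · rw [br_e, ex_ge x (by omega), ex_ge y (by omega)]; simp
  · rw [br_f, fx_ge x (by omega), fx_ge y (by omega)]; simp

lemma det_ne (m : ℕ) (φ : V (m + 2) ≃ₗ[ℝ] V (m + 2))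
    (hφ : ∀ x y, φ (bracket _ x y) = bracket _ (φ x) (φ y)) :
    (!![φ (tt _) Bas.t, φ (ee _ (m + 1)) Bas.t, φ (ff _ (m + 1)) Bas.t;
        ex (φ (tt _)) (m + 1), ex (φ (ee _ (m + 1))) (m + 1), ex (φ (ff _ (m + 1))) (m + 1);
        fx (φ (tt _)) (m + 1), fx (φ (ee _ (m + 1))) (m + 1), fx (φ (ff _ (m + 1))) (m + 1)] :
        Matrix (Fin 3) (Fin 3) ℝ).det ≠ 0 := by
  have key : ∀ u : V (m + 2),
      u Bas.t = φ.symm u Bas.t * φ (tt _) Bas.t + ex (φ.symm u) (m + 1) * φ (ee _ (m + 1)) Bas.t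
        + fx (φ.symm u) (m + 1) * φ (ff _ (m + 1)) Bas.t ∧
      ex u (m + 1) = φ.symm u Bas.t * ex (φ (tt _)) (m + 1)
        + ex (φ.symm u) (m + 1) * ex (φ (ee _ (m + 1))) (m + 1)
        + fx (φ.symm u) (m + 1) * ex (φ (ff _ (m + 1))) (m + 1) ∧
      fx u (m + 1) = φ.symm u Bas.t * fx (φ (tt _)) (m + 1)
        + ex (φ.symm u) (m + 1) * fx (φ (ee _ (m + 1))) (m + 1)
        + fx (φ.symm u) (m + 1) * fx (φ (ff _ (m + 1))) (m + 1) := by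
    intro u
    obtain ⟨v, rfl⟩ := φ.surjective u
    simp only [LinearEquiv.symm_apply_apply]
    obtain ⟨a, b, c, d, h⟩ := derived m
      (v - (v Bas.t • tt _ + ex v (m + 1) • ee _ (m + 1) + fx v (m + 1) • ff _ (m + 1)))
      (by simp [tt_t, ee_t, ff_t]) (by simp [tt_e, ee_e, ff_e]) (by simp [tt_f, ee_f, ff_f])
    have h2 : φ v = v Bas.t • φ (tt _) + ex v (m + 1) • φ (ee _ (m + 1))
        + fx v (m + 1) • φ (ff _ (m + 1))
        + (bracket _ (φ a) (φ b) + bracket _ (φ c) (φ d)) := by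
      rw [← hφ, ← hφ, ← map_add φ (bracket _ a b), ← h]
      simp
    obtain ⟨p1, p2, p3⟩ := br_top m (φ a) (φ b)
    obtain ⟨q1, q2, q3⟩ := br_top m (φ c) (φ d)
    refine ⟨?_, ?_, ?_⟩
    · conv_lhs => rw [h2]
      simp [p1, q1]
    · conv_lhs => rw [h2]
      simp [p2, q2]
    · conv_lhs => rw [h2]
      simp [p3, q3]
  obtain ⟨a1, a2, a3⟩ := key (tt _)
  obtain ⟨b1, b2, b3⟩ := key (ee _ (m + 1))
  obtain ⟨c1, c2, c3⟩ := key (ff _ (m + 1))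
  simp only [tt_t, tt_e, tt_f, ee_t, ff_t, ee_f, ff_e, ee_e _ _ _ (show m + 1 < m + 2 by omega),
    ff_f _ _ _ (show m + 1 < m + 2 by omega), if_true] at a1 a2 a3 b1 b2 b3 c1 c2 c3
  set M := (!![φ (tt _) Bas.t, φ (ee _ (m + 1)) Bas.t, φ (ff _ (m + 1)) Bas.t;
        ex (φ (tt _)) (m + 1), ex (φ (ee _ (m + 1))) (m + 1), ex (φ (ff _ (m + 1))) (m + 1);
        fx (φ (tt _)) (m + 1), fx (φ (ee _ (m + 1))) (m + 1), fx (φ (ff _ (m + 1))) (m + 1)] :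
        Matrix (Fin 3) (Fin 3) ℝ) with hM
  let N : Matrix (Fin 3) (Fin 3) ℝ :=
    !![φ.symm (tt _) Bas.t, φ.symm (ee _ (m + 1)) Bas.t, φ.symm (ff _ (m + 1)) Bas.t;
       ex (φ.symm (tt _)) (m + 1), ex (φ.symm (ee _ (m + 1))) (m + 1),
         ex (φ.symm (ff _ (m + 1))) (m + 1);
       fx (φ.symm (tt _)) (m + 1), fx (φ.symm (ee _ (m + 1))) (m + 1),
         fx (φ.symm (ff _ (m + 1))) (m + 1)]
  have hMN : M * N = 1 := by
    ext i j
    fin_cases i <;> fin_cases j <;>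
      simp [hM, N, Matrix.mul_apply, Fin.sum_univ_three] <;> linarith
  intro h0
  have := congrArg Matrix.det hMN
  rw [Matrix.det_mul, h0] at this
  simp at this

lemma iso_data (m : ℕ) (α β : ℝ) (D' : V (m + 2) → V (m + 2) → V (m + 2))
    (h : LSAIso (m + 2) (lsa (m + 2) α β) D') : ∃ x y w : V (m + 2),
    D' x x = 0 ∧ D' y y = 0 ∧ D' w w = 0 ∧
    D' x y = αseq α (m + 1) • bracket _ x y ∧
    D' x w = (-βseq β (m + 1)) • bracket _ x w ∧
    (1 ≤ m → D' y w = 0 ∧ D' w y = 0) ∧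
    (!![x Bas.t, y Bas.t, w Bas.t; ex x (m + 1), ex y (m + 1), ex w (m + 1);
        fx x (m + 1), fx y (m + 1), fx w (m + 1)] : Matrix (Fin 3) (Fin 3) ℝ).det ≠ 0 := by
  obtain ⟨φ, hb, hD⟩ := h
  refine ⟨φ (tt _), φ (ee _ (m + 1)), φ (ff _ (m + 1)), ?_, ?_, ?_, ?_, ?_, ?_, det_ne m φ hb⟩
  · rw [← hD, lsa_tt, map_zero]
  · rw [← hD, lsa_ee, map_zero]
  · rw [← hD, lsa_ff, map_zero]
  · rw [← hD, ← hb, lsa_te, map_smul]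
  · rw [← hD, ← hb, lsa_tf, map_smul]
  · intro hm
    rw [← hD, ← hD, lsa_ef m hm, lsa_fe m hm, map_zero]
    simp

lemma α_gt {α : ℝ} (hα : 1 < α) (m : ℕ) : 1 < αseq α (m + 1) := by
  rw [αseq_eq hα]
  have : 0 < (α - 1) / ((m : ℝ) * (α - 1) + 1) := div_pos (by linarith) (denA hα m)
  linarith

lemma β_lt {β : ℝ} (hβ : 1 < β) (j : ℕ) : βseq β (j + 2) < -1 := by
  rw [βseq_eq hβ]
  have : 0 < (β + 1) / (((j : ℝ) + 1) * (β + 1) - 1) := div_pos (by linarith) (denB hβ j)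
  linarith

lemma αβ_lt {α β : ℝ} (hα : 1 < α) (hβ : 1 < β) (j : ℕ) :
    αseq α (j + 2) < -βseq β (j + 2) := by
  have h1 := denA hα (j + 1)
  have h2 := denB hβ j
  rw [βseq_eq hβ, αseq_eq hα]
  have : (α - 1) / (((j + 1 : ℕ) : ℝ) * (α - 1) + 1) < (β + 1) / (((j : ℝ) + 1) * (β + 1) - 1) := by
    rw [div_lt_div_iff₀ h1 h2]
    push_cast
    nlinarith
  linarith

lemma α_inj {α α' : ℝ} (hα : 1 < α) (hα' : 1 < α') (m : ℕ)
    (h : αseq α (m + 1) = αseq α' (m + 1)) : α = α' := by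
  have h1 := denA hα m
  have h2 := denA hα' m
  rw [αseq_eq hα, αseq_eq hα', add_right_inj, div_eq_div_iff h1.ne' h2.ne'] at h
  linarith

lemma β_inj {β β' : ℝ} (hβ : 1 < β) (hβ' : 1 < β') (m : ℕ)
    (h : βseq β (m + 1) = βseq β' (m + 1)) : β = β' := by
  cases m with
  | zero => simpa [βseq_one] using h
  | succ j =>
    have h1 := denB hβ j
    have h2 := denB hβ' j
    rw [show j + 1 + 1 = j + 2 by ring, βseq_eq hβ, βseq_eq hβ', sub_right_inj,
      div_eq_div_iff h1.ne' h2.ne'] at h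
    linarith

lemma γ_bounds {α β : ℝ} (hα : 1 < α) (hβ : 1 < β) :
    0 < γseq 2 α β 1 ∧ γseq 2 α β 1 < 1 / 2 := by
  have h3 := denC (α := α) (β := β) 2 (by omega) hα hβ
  have h4 : 0 < (α - 1) * β := mul_pos (by linarith) (by linarith)
  unfold γseq
  push_cast at h3 ⊢
  constructor
  · apply div_pos _ h3
    nlinarith
  · rw [div_lt_div_iff₀ h3 (by norm_num)]
    nlinarith

lemma alg_big {a b a' b' p1 p2 p3 q1 q2 q3 r1 r2 r3 : ℝ}
    (ha' : 1 < a') (hb' : b' < -1) (h1 : a' < -b) (h2 : a < -b')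
    (yye : a' * (q1 * q2) + (a' - 1) * (q2 * q1) = 0)
    (yyf : b' * (q1 * q3) + (b' + 1) * (q3 * q1) = 0)
    (wwe : a' * (r1 * r2) + (a' - 1) * (r2 * r1) = 0)
    (wwf : b' * (r1 * r3) + (b' + 1) * (r3 * r1) = 0)
    (ywe : a' * (q1 * r2) + (a' - 1) * (q2 * r1) = 0)
    (ywf : b' * (q1 * r3) + (b' + 1) * (q3 * r1) = 0)
    (wye : a' * (r1 * q2) + (a' - 1) * (r2 * q1) = 0)
    (wyf : b' * (r1 * q3) + (b' + 1) * (r3 * q1) = 0)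
    (xye : a' * (p1 * q2) + (a' - 1) * (p2 * q1) = a * (p1 * q2 - p2 * q1))
    (xyf : b' * (p1 * q3) + (b' + 1) * (p3 * q1) = a * (-(p1 * q3) + p3 * q1))
    (xwe : a' * (p1 * r2) + (a' - 1) * (p2 * r1) = -b * (p1 * r2 - p2 * r1))
    (xwf : b' * (p1 * r3) + (b' + 1) * (p3 * r1) = -b * (-(p1 * r3) + p3 * r1))
    (hdet : p1 * q2 * r3 - p1 * r2 * q3 - q1 * p2 * r3 + q1 * r2 * p3
      + r1 * p2 * q3 - r1 * q2 * p3 ≠ 0) : a = a' ∧ b = b' := by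
  have ca : (2 * a' - 1) ≠ 0 := by intro h; linarith
  have cb : (2 * b' + 1) ≠ 0 := by intro h; linarith
  have A1 : q1 * q2 = 0 := by apply mul_left_cancel₀ ca; linarith
  have A2 : q1 * q3 = 0 := by apply mul_left_cancel₀ cb; linarith
  have A3 : r1 * r2 = 0 := by apply mul_left_cancel₀ ca; linarith
  have A4 : r1 * r3 = 0 := by apply mul_left_cancel₀ cb; linarith
  have B1 : q1 * r2 = 0 := by
    apply mul_left_cancel₀ ca
    linear_combination a' * ywe - (a' - 1) * wye
  have B2 : q1 * r3 = 0 := by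
    apply mul_left_cancel₀ cb
    linear_combination (b' + 1) * wyf - b' * ywf
  have B3 : r1 * q2 = 0 := by
    apply mul_left_cancel₀ ca
    linear_combination a' * wye - (a' - 1) * ywe
  have B4 : r1 * q3 = 0 := by
    apply mul_left_cancel₀ cb
    linear_combination (b' + 1) * ywf - b' * wyf
  have q10 : q1 = 0 := by
    by_contra h
    simp only [mul_eq_zero, h, false_or] at A1 A2 B1 B2
    apply hdet; rw [A1, A2, B1, B2]; ring
  have r10 : r1 = 0 := by
    by_contra h
    simp only [mul_eq_zero, h, false_or] at A3 A4 B3 B4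
    apply hdet; rw [A3, A4, B3, B4]; ring
  subst q10 r10
  have p10 : p1 ≠ 0 := by rintro rfl; apply hdet; ring
  have C1 : r2 = 0 := by
    have : (a' + b) * p1 * r2 = 0 := by linear_combination xwe
    have h' : a' + b ≠ 0 := by intro h; linarith
    simpa [h', p10] using this
  have C2 : q3 = 0 := by
    have : (b' + a) * p1 * q3 = 0 := by linear_combination xyf
    have h' : b' + a ≠ 0 := by intro h; linarith
    simpa [h', p10] using this
  subst C1 C2
  have q20 : q2 ≠ 0 := by rintro rfl; apply hdet; ring
  have r30 : r3 ≠ 0 := by rintro rfl; apply hdet; ring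
  constructor
  · have : (a - a') * p1 * q2 = 0 := by linear_combination -xye
    have : a - a' = 0 := by simpa [p10, q20] using this
    linarith
  · have : (b - b') * p1 * r3 = 0 := by linear_combination -xwf
    have : b - b' = 0 := by simpa [p10, r30] using this
    linarith

lemma axes {p1 p2 p3 : ℝ} (h1 : p1 * p2 = 0) (h2 : p1 * p3 = 0) (h3 : p2 * p3 = 0) :
    (p2 = 0 ∧ p3 = 0) ∨ (p1 = 0 ∧ p3 = 0) ∨ (p1 = 0 ∧ p2 = 0) := by
  rcases mul_eq_zero.mp h1 with h | h <;> rcases mul_eq_zero.mp h2 with h' | h' <;>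
    rcases mul_eq_zero.mp h3 with h'' | h'' <;> simp_all

lemma alg_two {a b a' b' c p1 p2 p3 q1 q2 q3 r1 r2 r3 : ℝ}
    (ha : 1 < a) (hb : 1 < b) (ha' : 1 < a') (hb' : 1 < b') (hc0 : 0 < c) (hc : c < 1 / 2)
    (xxe : a' * (p1 * p2) + (a' - 1) * (p2 * p1) = 0)
    (xxf : b' * (p1 * p3) + (b' + 1) * (p3 * p1) = 0)
    (xxz : c * (p2 * p3) + (c - 1) * (p3 * p2) = 0)
    (yye : a' * (q1 * q2) + (a' - 1) * (q2 * q1) = 0)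
    (yyf : b' * (q1 * q3) + (b' + 1) * (q3 * q1) = 0)
    (yyz : c * (q2 * q3) + (c - 1) * (q3 * q2) = 0)
    (wwe : a' * (r1 * r2) + (a' - 1) * (r2 * r1) = 0)
    (wwf : b' * (r1 * r3) + (b' + 1) * (r3 * r1) = 0)
    (wwz : c * (r2 * r3) + (c - 1) * (r3 * r2) = 0)
    (xye : a' * (p1 * q2) + (a' - 1) * (p2 * q1) = a * (p1 * q2 - p2 * q1))
    (xyf : b' * (p1 * q3) + (b' + 1) * (p3 * q1) = a * (-(p1 * q3) + p3 * q1))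
    (xyz : c * (p2 * q3) + (c - 1) * (p3 * q2) = a * (p2 * q3 - p3 * q2))
    (xwe : a' * (p1 * r2) + (a' - 1) * (p2 * r1) = -b * (p1 * r2 - p2 * r1))
    (xwf : b' * (p1 * r3) + (b' + 1) * (p3 * r1) = -b * (-(p1 * r3) + p3 * r1))
    (xwz : c * (p2 * r3) + (c - 1) * (p3 * r2) = -b * (p2 * r3 - p3 * r2))
    (hdet : p1 * q2 * r3 - p1 * r2 * q3 - q1 * p2 * r3 + q1 * r2 * p3
      + r1 * p2 * q3 - r1 * q2 * p3 ≠ 0) : a = a' ∧ b = b' := by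
  have ca : (2 * a' - 1) ≠ 0 := by intro h; linarith
  have cb : (2 * b' + 1) ≠ 0 := by intro h; linarith
  have cc : (2 * c - 1) ≠ 0 := by intro h; linarith
  have X := axes (p1 := p1) (p2 := p2) (p3 := p3) (by apply mul_left_cancel₀ ca; linarith)
    (by apply mul_left_cancel₀ cb; linarith) (by apply mul_left_cancel₀ cc; linarith)
  have Y := axes (p1 := q1) (p2 := q2) (p3 := q3) (by apply mul_left_cancel₀ ca; linarith)
    (by apply mul_left_cancel₀ cb; linarith) (by apply mul_left_cancel₀ cc; linarith)
  have W := axes (p1 := r1) (p2 := r2) (p3 := r3) (by apply mul_left_cancel₀ ca; linarith)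
    (by apply mul_left_cancel₀ cb; linarith) (by apply mul_left_cancel₀ cc; linarith)
  clear xxe xxf xxz yye yyf yyz wwe wwf wwz
  have cancel : ∀ {s u v : ℝ}, s * (u * v) = 0 → u ≠ 0 → v ≠ 0 → s = 0 := by
    intro s u v h hu hv
    simpa [hu, hv] using h
  rcases X with ⟨rfl, rfl⟩ | ⟨rfl, rfl⟩ | ⟨rfl, rfl⟩ <;>
  rcases Y with ⟨rfl, rfl⟩ | ⟨rfl, rfl⟩ | ⟨rfl, rfl⟩ <;>
  rcases W with ⟨rfl, rfl⟩ | ⟨rfl, rfl⟩ | ⟨rfl, rfl⟩ <;>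
  first
  | (exfalso; apply hdet; ring; done)
  | skip
  ·
    have hp : p1 ≠ 0 := by rintro rfl; apply hdet; ring
    have hq : q2 ≠ 0 := by rintro rfl; apply hdet; ring
    have hr : r3 ≠ 0 := by rintro rfl; apply hdet; ring
    have e1 := cancel (s := a - a') (u := p1) (v := q2) (by linear_combination -xye) hp hq
    have e2 := cancel (s := b - b') (u := p1) (v := r3) (by linear_combination -xwf) hp hr
    constructor <;> linarith
  · have hp : p1 ≠ 0 := by rintro rfl; apply hdet; ring
    have hq : q3 ≠ 0 := by rintro rfl; apply hdet; ring
    have e1 := cancel (s := a + b') (u := p1) (v := q3) (by linear_combination xyf) hp hq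
    exfalso; linarith
  · have hp : p2 ≠ 0 := by rintro rfl; apply hdet; ring
    have hq : q1 ≠ 0 := by rintro rfl; apply hdet; ring
    have e1 := cancel (s := a + a' - 1) (u := p2) (v := q1) (by linear_combination xye) hp hq
    exfalso; linarith
  · have hp : p2 ≠ 0 := by rintro rfl; apply hdet; ring
    have hq : q3 ≠ 0 := by rintro rfl; apply hdet; ring
    have e1 := cancel (s := c - a) (u := p2) (v := q3) (by linear_combination xyz) hp hq
    exfalso; linarith
  · have hp : p3 ≠ 0 := by rintro rfl; apply hdet; ring
    have hr : r2 ≠ 0 := by rintro rfl; apply hdet; ring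
    have e1 := cancel (s := c - 1 - b) (u := p3) (v := r2) (by linear_combination xwz) hp hr
    exfalso; linarith
  · have hp : p3 ≠ 0 := by rintro rfl; apply hdet; ring
    have hr : r1 ≠ 0 := by rintro rfl; apply hdet; ring
    have e1 := cancel (s := b' + 1 + b) (u := p3) (v := r1) (by linear_combination xwf) hp hr
    exfalso; linarith

lemma lsa_z_two (α β : ℝ) (x y : V (0 + 2)) : lsa (0 + 2) α β x y Bas.z =
    γseq 2 α β 1 * (ex x (0 + 1) * fx y (0 + 1))
      + (γseq 2 α β 1 - 1) * (fx x (0 + 1) * ex y (0 + 1)) := by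
  rw [lsa_z]
  simp [Finset.Nat.antidiagonal_succ, ex_ge, fx_ge]

lemma br_z_two (x y : V (0 + 2)) : bracket (0 + 2) x y Bas.z =
    ex x (0 + 1) * fx y (0 + 1) - fx x (0 + 1) * ex y (0 + 1) := by
  rw [br_z]
  simp [Finset.Nat.antidiagonal_succ, ex_ge, fx_ge]

lemma iso_eq (m : ℕ) {α β α' β' : ℝ} (hα : 1 < α) (hβ : 1 < β) (hα' : 1 < α') (hβ' : 1 < β')
    (h : LSAIso (m + 2) (lsa (m + 2) α β) (lsa (m + 2) α' β')) : α = α' ∧ β = β' := by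
  obtain ⟨x, y, w, hxx, hyy, hww, hxy, hxw, hyw, hdet⟩ := iso_data m α β _ h
  simp only [Matrix.det_fin_three, Matrix.of_apply, Matrix.cons_val] at hdet
  have E0 : ∀ {u v : V (m + 2)}, lsa (m + 2) α' β' u v = 0 →
      αseq α' (m + 1) * (u Bas.t * ex v (m + 1))
        + (αseq α' (m + 1) - 1) * (ex u (m + 1) * v Bas.t) = 0 := by
    intro u v h
    rw [← lsa_e (m + 2) α' β', h, ex_zero]
  have F0 : ∀ {u v : V (m + 2)}, lsa (m + 2) α' β' u v = 0 →
      βseq β' (m + 1) * (u Bas.t * fx v (m + 1))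
        + (βseq β' (m + 1) + 1) * (fx u (m + 1) * v Bas.t) = 0 := by
    intro u v h
    rw [← lsa_f (m + 2) α' β', h, fx_zero]
  have E1 : ∀ {s : ℝ} {u v : V (m + 2)}, lsa (m + 2) α' β' u v = s • bracket (m + 2) u v →
      αseq α' (m + 1) * (u Bas.t * ex v (m + 1))
        + (αseq α' (m + 1) - 1) * (ex u (m + 1) * v Bas.t)
        = s * (u Bas.t * ex v (m + 1) - ex u (m + 1) * v Bas.t) := by
    intro s u v h
    rw [← lsa_e (m + 2) α' β', h, ex_smul, br_e]
  have F1 : ∀ {s : ℝ} {u v : V (m + 2)}, lsa (m + 2) α' β' u v = s • bracket (m + 2) u v →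
      βseq β' (m + 1) * (u Bas.t * fx v (m + 1))
        + (βseq β' (m + 1) + 1) * (fx u (m + 1) * v Bas.t)
        = s * (-(u Bas.t * fx v (m + 1)) + fx u (m + 1) * v Bas.t) := by
    intro s u v h
    rw [← lsa_f (m + 2) α' β', h, fx_smul, br_f]
  suffices H : αseq α (m + 1) = αseq α' (m + 1) ∧ βseq β (m + 1) = βseq β' (m + 1) from
    ⟨α_inj hα hα' m H.1, β_inj hβ hβ' m H.2⟩
  cases m with
  | zero =>
    obtain ⟨c0, c1⟩ := γ_bounds hα' hβ'
    have Z0 : ∀ {u v : V (0 + 2)}, lsa (0 + 2) α' β' u v = 0 →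
        γseq 2 α' β' 1 * (ex u (0 + 1) * fx v (0 + 1))
          + (γseq 2 α' β' 1 - 1) * (fx u (0 + 1) * ex v (0 + 1)) = 0 := by
      intro u v h
      rw [← lsa_z_two, h, Pi.zero_apply]
    have Z1 : ∀ {s : ℝ} {u v : V (0 + 2)}, lsa (0 + 2) α' β' u v = s • bracket (0 + 2) u v →
        γseq 2 α' β' 1 * (ex u (0 + 1) * fx v (0 + 1))
          + (γseq 2 α' β' 1 - 1) * (fx u (0 + 1) * ex v (0 + 1))
          = s * (ex u (0 + 1) * fx v (0 + 1) - fx u (0 + 1) * ex v (0 + 1)) := by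
      intro s u v h
      rw [← lsa_z_two, h, ← br_z_two, Pi.smul_apply, smul_eq_mul]
    exact alg_two (α_gt hα 0) (by rw [zero_add, βseq_one]; exact hβ) (α_gt hα' 0)
      (by rw [zero_add, βseq_one]; exact hβ') c0 c1
      (E0 hxx) (F0 hxx) (Z0 hxx) (E0 hyy) (F0 hyy) (Z0 hyy) (E0 hww) (F0 hww) (Z0 hww)
      (E1 hxy) (F1 hxy) (Z1 hxy) (E1 hxw) (F1 hxw) (Z1 hxw)
      (fun h => hdet (by linear_combination h))
  | succ j =>
    obtain ⟨h1, h2⟩ := hyw (by omega)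
    exact alg_big (α_gt hα' _) (β_lt hβ' j) (αβ_lt hα' hβ j) (αβ_lt hα hβ' j)
      (E0 hyy) (F0 hyy) (E0 hww) (F0 hww) (E0 h1) (F0 h1) (E0 h2) (F0 h2)
      (E1 hxy) (F1 hxy) (E1 hxw) (F1 hxw)
      (fun h => hdet (by linear_combination h))

lemma iso_refl (n : ℕ) (D : V n → V n → V n) : LSAIso n D D :=
  ⟨LinearEquiv.refl ℝ _, fun _ _ => rfl, fun _ _ => rfl⟩

/-- for distinct pairs in
`A = {(α,β) | α > 1, β > 1, n(α-1)(β+1) - α + β + 2 ≠ 0}` the structures `∆_{(α,β)}`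
are pairwise non-isomorphic; in particular `T*g` admits uncountably many pairwise
non-isomorphic complete left-symmetric structures. -/
theorem stmt4 (n : ℕ) (hn : 2 ≤ n) :
    (∀ α β α' β' : ℝ,
      1 < α → 1 < β → (n : ℝ) * (α - 1) * (β + 1) - α + β + 2 ≠ 0 →
      1 < α' → 1 < β' → (n : ℝ) * (α' - 1) * (β' + 1) - α' + β' + 2 ≠ 0 →
      (α, β) ≠ (α', β') →
      ¬ LSAIso n (lsa n α β) (lsa n α' β')) ∧
    ∃ S : Set (V n → V n → V n),
      ¬ S.Countable ∧
      (∀ D ∈ S, IsBilin n D ∧ IsLSA n D ∧ IsComplete n D) ∧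
      (∀ D ∈ S, ∀ D' ∈ S, D ≠ D' → ¬ LSAIso n D D') := by
  obtain ⟨m, rfl⟩ := Nat.exists_eq_add_of_le' hn
  constructor
  · intro α β α' β' hα hβ _ hα' hβ' _ hne h
    obtain ⟨h1, h2⟩ := iso_eq m hα hβ hα' hβ' h
    exact hne (by rw [h1, h2])
  · refine ⟨Set.image (fun α => lsa (m + 2) α 2) (Set.Ioi 1), ?_, ?_, ?_⟩
    · intro hc
      have hinj : Set.InjOn (fun α => lsa (m + 2) α 2) (Set.Ioi (1 : ℝ)) := by
        intro α hα α' hα' heq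
        have heq' : lsa (m + 2) α 2 = lsa (m + 2) α' 2 := heq
        refine (iso_eq m (β := 2) (β' := 2) hα (by norm_num) hα' (by norm_num) ?_).1
        rw [heq']
        exact iso_refl _ _
      have h1 := Set.countable_of_injective_of_countable_image hinj hc
      have h2 := Cardinal.le_aleph0_iff_set_countable.mpr h1
      rw [Cardinal.mk_Ioi_real] at h2
      exact absurd h2 (not_le.mpr Cardinal.aleph0_lt_continuum)
    · rintro _ ⟨α, hα, rfl⟩
      exact ⟨lsa_bilin _ _ _, ⟨lsa_assoc _ hα (by norm_num), lsa_br _ _ _⟩, lsa_complete _ _ _⟩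
    · rintro _ ⟨α, hα, rfl⟩ _ ⟨α', hα', rfl⟩ hne h
      have := (iso_eq m (β := 2) (β' := 2) hα (by norm_num) hα' (by norm_num) h).1
      exact hne (by rw [this])

end Paper
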